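/- (Sub-normalization of probabilistic two-step networks) Let C₁ be the Choi matrix of a quantum channel from Matrix (Fin d₀) ℂ to Matrix (Fin d₁ × Fin a) ℂ and C₂ the Choi matrix of a quantum channel from Matrix (Fin a × Fin d₂) ℂ to Matrix (Fin d₃) ℂ, and let E₁, E₂ be positive semidefinite matrices with 0 ≤ E₁ ≤ C₁ and 0 ≤ E₂ ≤ C₂ in the positive semidefinite order. Then the link products over the ancilla factor a satisfy 0 ≤ E₂ * E₁ ≤ C₂ * C₁; moreover C₂ * C₁ is the Choi matrix of a deterministic two-step network, i.e. it is positive semidefinite and satisfies Tr₃[C₂ * C₁] = I_{d₂} ⊗ Tr_a[C₁] with Tr₁[Tr_a[C₁]] = I_{d₀}. -/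

import Mathlib

open Matrix
open scoped ComplexOrder

/-- Partial trace over the first factor of a tensor product. -/
noncomputable def ptrFst {A B : Type*} [Fintype A]
    (Y : Matrix (A × B) (A × B) ℂ) : Matrix B B ℂ :=
  Matrix.of fun b b' => ∑ x : A, Y (x, b) (x, b')

/-- Partial trace over the first two factors of a triple tensor product. -/
noncomputable def ptrFstSnd {A B C : Type*} [Fintype A] [Fintype B]
    (Y : Matrix (A × B × C) (A × B × C) ℂ) : Matrix C C ℂ :=
  Matrix.of fun c c' => ∑ x : A, ∑ y : B, Y (x, y, c) (x, y, c')

/-- Partial trace over the middle factor of a triple tensor product. -/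
noncomputable def ptrMid {A B C : Type*} [Fintype B]
    (Y : Matrix (A × B × C) (A × B × C) ℂ) : Matrix (A × C) (A × C) ℂ :=
  Matrix.of fun p q => ∑ y : B, Y (p.1, y, p.2) (q.1, y, q.2)

/-- `X₁^{T_a} ⊗ I_{d₃ d₂}` on `ℂ^{d₃} ⊗ ℂ^{d₂} ⊗ ℂ^{d₁} ⊗ ℂ^{a} ⊗ ℂ^{d₀}`. -/
noncomputable def fac₁ (d₃ d₂ : ℕ) {d₁ a d₀ : ℕ}
    (X₁ : Matrix (Fin d₁ × Fin a × Fin d₀) (Fin d₁ × Fin a × Fin d₀) ℂ) :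
    Matrix (Fin d₃ × Fin d₂ × Fin d₁ × Fin a × Fin d₀)
      (Fin d₃ × Fin d₂ × Fin d₁ × Fin a × Fin d₀) ℂ :=
  Matrix.of fun r s =>
    (if r.1 = s.1 then (1 : ℂ) else 0) * (if r.2.1 = s.2.1 then (1 : ℂ) else 0) *
      X₁ (r.2.2.1, s.2.2.2.1, r.2.2.2.2) (s.2.2.1, r.2.2.2.1, s.2.2.2.2)

/-- `I_{d₁ d₀} ⊗ X₂` on `ℂ^{d₃} ⊗ ℂ^{d₂} ⊗ ℂ^{d₁} ⊗ ℂ^{a} ⊗ ℂ^{d₀}`. -/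
noncomputable def fac₂ (d₁ d₀ : ℕ) {d₃ a d₂ : ℕ}
    (X₂ : Matrix (Fin d₃ × Fin a × Fin d₂) (Fin d₃ × Fin a × Fin d₂) ℂ) :
    Matrix (Fin d₃ × Fin d₂ × Fin d₁ × Fin a × Fin d₀)
      (Fin d₃ × Fin d₂ × Fin d₁ × Fin a × Fin d₀) ℂ :=
  Matrix.of fun r s =>
    (if r.2.2.1 = s.2.2.1 then (1 : ℂ) else 0) *
      (if r.2.2.2.2 = s.2.2.2.2 then (1 : ℂ) else 0) *
      X₂ (r.1, r.2.2.2.1, r.2.1) (s.1, s.2.2.2.1, s.2.1)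

/-- The link product `X₂ * X₁ = Tr_a[(X₁^{T_a} ⊗ I)(I ⊗ X₂)]` over the
ancilla factor `a`. -/
noncomputable def link2 {d₁ a d₀ d₃ d₂ : ℕ}
    (X₁ : Matrix (Fin d₁ × Fin a × Fin d₀) (Fin d₁ × Fin a × Fin d₀) ℂ)
    (X₂ : Matrix (Fin d₃ × Fin a × Fin d₂) (Fin d₃ × Fin a × Fin d₂) ℂ) :
    Matrix (Fin d₃ × Fin d₂ × Fin d₁ × Fin d₀)
      (Fin d₃ × Fin d₂ × Fin d₁ × Fin d₀) ℂ :=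
  Matrix.of fun p q => ∑ β : Fin a,
    (fac₁ d₃ d₂ X₁ * fac₂ d₁ d₀ X₂)
      (p.1, p.2.1, p.2.2.1, β, p.2.2.2) (q.1, q.2.1, q.2.2.1, β, q.2.2.2)

/-- Entrywise formula for the link product. -/
theorem link2_entry {d₁ a d₀ d₃ d₂ : ℕ}
    (X₁ : Matrix (Fin d₁ × Fin a × Fin d₀) (Fin d₁ × Fin a × Fin d₀) ℂ)
    (X₂ : Matrix (Fin d₃ × Fin a × Fin d₂) (Fin d₃ × Fin a × Fin d₂) ℂ)
    (p q : Fin d₃ × Fin d₂ × Fin d₁ × Fin d₀) :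
    link2 X₁ X₂ p q = ∑ β : Fin a, ∑ γ : Fin a,
      X₁ (p.2.2.1, γ, p.2.2.2) (q.2.2.1, β, q.2.2.2) *
        X₂ (p.1, γ, p.2.1) (q.1, β, q.2.1) := by
  simp only [link2, fac₁, fac₂, Matrix.of_apply, Matrix.mul_apply, Fintype.sum_prod_type]
  refine Finset.sum_congr rfl fun β _ => ?_
  rw [Finset.sum_eq_single p.1 (by intro b _ hb; simp [hb.symm]) (by simp)]
  rw [Finset.sum_eq_single p.2.1 (by intro b _ hb; simp [hb.symm]) (by simp)]
  rw [Finset.sum_eq_single q.2.2.1 (by intro b _ hb; simp [hb]) (by simp)]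
  refine Finset.sum_congr rfl fun γ _ => ?_
  rw [Finset.sum_eq_single q.2.2.2 (by intro b _ hb; simp [hb]) (by simp)]
  simp

/-- The link product of positive semidefinite matrices is positive semidefinite. -/
theorem link2_posSemidef {d₁ a d₀ d₃ d₂ : ℕ}
    {X₁ : Matrix (Fin d₁ × Fin a × Fin d₀) (Fin d₁ × Fin a × Fin d₀) ℂ}
    {X₂ : Matrix (Fin d₃ × Fin a × Fin d₂) (Fin d₃ × Fin a × Fin d₂) ℂ}
    (h₁ : X₁.PosSemidef) (h₂ : X₂.PosSemidef) : (link2 X₁ X₂).PosSemidef := by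
  let f : (Fin d₃ × Fin d₂ × Fin d₁ × Fin d₀) × Fin a →
      (Fin d₁ × Fin a × Fin d₀) × (Fin d₃ × Fin a × Fin d₂) :=
    fun r => ((r.1.2.2.1, r.2, r.1.2.2.2), (r.1.1, r.2, r.1.2.1))
  let V : Matrix ((Fin d₃ × Fin d₂ × Fin d₁ × Fin d₀) × Fin a)
      (Fin d₃ × Fin d₂ × Fin d₁ × Fin d₀) ℂ :=
    Matrix.of fun r q => if r.1 = q then 1 else 0
  have h := ((h₁.kronecker h₂).submatrix f).conjTranspose_mul_mul_same V
  suffices hs : link2 X₁ X₂ =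
      Vᴴ * (Matrix.kroneckerMap (fun x y => x * y) X₁ X₂).submatrix f f * V by
    rw [hs]
    exact h
  ext p q
  rw [link2_entry]
  simp only [Matrix.mul_apply, Matrix.conjTranspose_apply, Matrix.submatrix_apply,
    Matrix.kroneckerMap_apply, V, f, Matrix.of_apply]
  rw [Fintype.sum_prod_type, Finset.sum_eq_single q (by intro b _ hb; simp [hb]) (by simp)]
  refine Finset.sum_congr rfl fun β _ => ?_
  rw [Fintype.sum_prod_type, Finset.sum_eq_single p (by intro b _ hb; simp [hb]) (by simp)]
  simp

/-- Sub-normalization of probabilistic two-step networks: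
if `0 ≤ E₁ ≤ C₁` and `0 ≤ E₂ ≤ C₂` with `C₁, C₂` Choi matrices of channels,
then `0 ≤ E₂ * E₁ ≤ C₂ * C₁`, and `C₂ * C₁` is the Choi matrix of a
deterministic two-step network. -/
theorem two_step_subnormalization (d₀ d₁ d₂ d₃ a : ℕ)
    (C₁ E₁ : Matrix (Fin d₁ × Fin a × Fin d₀) (Fin d₁ × Fin a × Fin d₀) ℂ)
    (C₂ E₂ : Matrix (Fin d₃ × Fin a × Fin d₂) (Fin d₃ × Fin a × Fin d₂) ℂ)
    (h₁pos : C₁.PosSemidef) (h₁tp : ptrFstSnd C₁ = 1)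
    (h₂pos : C₂.PosSemidef) (h₂tp : ptrFst C₂ = 1)
    (hE₁pos : E₁.PosSemidef) (hE₁le : (C₁ - E₁).PosSemidef)
    (hE₂pos : E₂.PosSemidef) (hE₂le : (C₂ - E₂).PosSemidef) :
    (link2 E₁ E₂).PosSemidef ∧
    (link2 C₁ C₂ - link2 E₁ E₂).PosSemidef ∧
    (link2 C₁ C₂).PosSemidef ∧
    ptrFst (link2 C₁ C₂) =
      Matrix.of (fun p q => (if p.1 = q.1 then (1 : ℂ) else 0) *
        ptrMid C₁ (p.2.1, p.2.2) (q.2.1, q.2.2)) ∧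
    ptrFst (ptrMid C₁) = 1 := by
  refine ⟨link2_posSemidef hE₁pos hE₂pos, ?_, link2_posSemidef h₁pos h₂pos, ?_, ?_⟩
  · have h := (link2_posSemidef hE₁le h₂pos).add (link2_posSemidef hE₁pos hE₂le)
    suffices hs : link2 C₁ C₂ - link2 E₁ E₂ =
        link2 (C₁ - E₁) C₂ + link2 E₁ (C₂ - E₂) by
      rw [hs]
      exact h
    ext p q
    simp only [Matrix.sub_apply, Matrix.add_apply, link2_entry, ← Finset.sum_sub_distrib,
      ← Finset.sum_add_distrib]
    refine Finset.sum_congr rfl fun β _ => Finset.sum_congr rfl fun γ _ => ?_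
    ring
  · have key : ∀ r s, ∑ x, C₂ (x, r) (x, s) = if r = s then 1 else 0 := by
      intro r s
      have := congrFun (congrFun h₂tp r) s
      simpa [ptrFst, Matrix.one_apply] using this
    ext p q
    simp only [ptrFst, Matrix.of_apply, link2_entry, ptrMid]
    rw [Finset.sum_comm, Finset.mul_sum]
    refine Finset.sum_congr rfl fun β _ => ?_
    rw [Finset.sum_comm]
    simp only [← Finset.mul_sum, key, Prod.mk.injEq]
    rw [Finset.sum_eq_single β (by intro b _ hb; simp [hb]) (by simp)]
    simp
  · rw [← h₁tp]
    rfl
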